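/- arXiv:2603.27795 — 2 statements merged into one kernel-verified Lean document; each statement's English description precedes it below -/
import Mathlib

section
/- Let Z = |MVC(G*)| and opt = E[Z]. Then for every t with 0 ≤ t ≤ opt, Pr[|Z - opt| > t] ≤ 2·exp(−(t²/33)/opt). -/
open Finset

noncomputable section
open scoped Classical

variable {V : Type*} [Fintype V] [DecidableEq V]

/-- The probability that the realized graph `G* ~ G_p` (each edge of the base edge set `E`
kept independently with probability `p`) has edge set exactly `F`. -/
def edgeWeight (p : ℝ) (E F : Finset (Sym2 V)) : ℝ :=
  p ^ F.card * (1 - p) ^ (E \ F).card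

/-- The probability of an event `A` of the realized graph `G* ~ G_p`, where `E` is the
edge set of the base graph. -/
def probEvent (p : ℝ) (E : Finset (Sym2 V)) (A : Finset (Sym2 V) → Prop) : ℝ :=
  ∑ F ∈ E.powerset, if A F then edgeWeight p E F else 0

/-- The expectation of a real-valued function of the realized graph `G* ~ G_p`. -/
def expVal (p : ℝ) (E : Finset (Sym2 V)) (X : Finset (Sym2 V) → ℝ) : ℝ :=
  ∑ F ∈ E.powerset, edgeWeight p E F * X F

/-- `C` is a vertex cover of the graph with edge set `F`. -/
def IsCoverOf (C : Finset V) (F : Finset (Sym2 V)) : Prop :=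
  ∀ e ∈ F, ∃ v ∈ C, v ∈ e

/-- `MVC` assigns to every spanning subgraph of the base graph (given by its edge set
`F ⊆ E`) a vertex cover of minimum size. -/
def IsMinCoverFn (E : Finset (Sym2 V)) (MVC : Finset (Sym2 V) → Finset V) : Prop :=
  ∀ F ⊆ E, IsCoverOf (MVC F) F ∧ ∀ C : Finset V, IsCoverOf C F → (MVC F).card ≤ C.card

/-- `opt = E[|MVC(G*)|]`. -/
def optVal (p : ℝ) (E : Finset (Sym2 V)) (MVC : Finset (Sym2 V) → Finset V) : ℝ :=
  expVal p E fun F => ((MVC F).card : ℝ)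

/-- The number of edges of the induced subgraph `G[V \ S]` of the base graph. -/
def inducedEdgeCount (G : SimpleGraph V) [DecidableRel G.Adj] (S : Finset V) : ℕ :=
  (G.edgeFinset.filter fun e => ∀ v ∈ e, v ∉ S).card

lemma expVal_empty (p : ℝ) (X : Finset (Sym2 V) → ℝ) : expVal p ∅ X = X ∅ := by
  simp [expVal, edgeWeight]

lemma expVal_insert (p : ℝ) (E : Finset (Sym2 V)) (e : Sym2 V) (he : e ∉ E)
    (X : Finset (Sym2 V) → ℝ) :
    expVal p (insert e E) X =
      (1 - p) * expVal p E X + p * expVal p E (fun F => X (insert e F)) := by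
  unfold expVal
  rw [Finset.sum_powerset_insert he, Finset.mul_sum, Finset.mul_sum]
  congr 1
  · refine Finset.sum_congr rfl fun F hF => ?_
    have hF' := Finset.mem_powerset.1 hF
    have h1 : e ∉ F := fun h => he (hF' h)
    have h2 : (insert e E \ F).card = (E \ F).card + 1 := by
      rw [Finset.insert_sdiff_of_notMem _ h1, Finset.card_insert_of_notMem]
      simp [he]
    unfold edgeWeight
    rw [h2]; ring
  · refine Finset.sum_congr rfl fun F hF => ?_
    have hF' := Finset.mem_powerset.1 hF
    have h1 : e ∉ F := fun h => he (hF' h)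
    have h2 : (insert e E \ insert e F) = (E \ F) := by
      ext x; simp only [Finset.mem_sdiff, Finset.mem_insert]
      constructor
      · rintro ⟨h | h, h'⟩
        · exact absurd (Or.inl h) h'
        · exact ⟨h, fun h3 => h' (Or.inr h3)⟩
      · rintro ⟨h, h'⟩
        refine ⟨Or.inr h, ?_⟩
        rintro (h3 | h3)
        · exact he (h3 ▸ h)
        · exact h' h3
    unfold edgeWeight
    rw [h2, Finset.card_insert_of_notMem h1]; ring

lemma expVal_add (p : ℝ) (E : Finset (Sym2 V)) (X Y : Finset (Sym2 V) → ℝ) :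
    expVal p E (fun F => X F + Y F) = expVal p E X + expVal p E Y := by
  simp [expVal, mul_add, Finset.sum_add_distrib]

lemma expVal_smul (p c : ℝ) (E : Finset (Sym2 V)) (X : Finset (Sym2 V) → ℝ) :
    expVal p E (fun F => c * X F) = c * expVal p E X := by
  simp only [expVal, Finset.mul_sum]
  exact Finset.sum_congr rfl fun F _ => by ring

lemma expVal_const (p c : ℝ) (E : Finset (Sym2 V)) : expVal p E (fun _ => c) = c := by
  induction E using Finset.induction_on with
  | empty => rw [expVal_empty]
  | insert e E he ih => rw [expVal_insert p E e he, ih]; ring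

lemma expVal_sum {ι : Type*} (p : ℝ) (E : Finset (Sym2 V)) (s : Finset ι)
    (X : ι → Finset (Sym2 V) → ℝ) :
    expVal p E (fun F => ∑ i ∈ s, X i F) = ∑ i ∈ s, expVal p E (X i) := by
  unfold expVal
  rw [Finset.sum_comm]
  exact Finset.sum_congr rfl fun F _ => by rw [Finset.mul_sum]

lemma edgeWeight_nonneg {p : ℝ} (hp0 : 0 < p) (hp1 : p ≤ 1) (E F : Finset (Sym2 V)) :
    0 ≤ edgeWeight p E F :=
  mul_nonneg (pow_nonneg hp0.le _) (pow_nonneg (by linarith) _)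

lemma expVal_mono {p : ℝ} (hp0 : 0 < p) (hp1 : p ≤ 1) (E : Finset (Sym2 V))
    {X Y : Finset (Sym2 V) → ℝ} (h : ∀ F ⊆ E, X F ≤ Y F) : expVal p E X ≤ expVal p E Y :=
  Finset.sum_le_sum fun F hF =>
    mul_le_mul_of_nonneg_left (h F (Finset.mem_powerset.1 hF)) (edgeWeight_nonneg hp0 hp1 E F)

lemma expVal_union (p : ℝ) (A B : Finset (Sym2 V)) (hAB : Disjoint A B)
    (X : Finset (Sym2 V) → ℝ) :
    expVal p (A ∪ B) X = expVal p A (fun F => expVal p B (fun F' => X (F ∪ F'))) := by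
  induction B using Finset.induction_on generalizing X with
  | empty => simp [expVal_empty]
  | insert e B he ih =>
    have h1 : e ∉ A := fun h => Finset.disjoint_left.1 hAB h (Finset.mem_insert_self _ _)
    have h2 : Disjoint A B := hAB.mono_right (Finset.subset_insert _ _)
    have h3 : e ∉ A ∪ B := by simp [h1, he]
    rw [Finset.union_insert, expVal_insert p _ e h3, ih h2, ih h2]
    simp_rw [expVal_insert p B e he]
    rw [expVal_add, expVal_smul, expVal_smul]
    simp [Finset.union_insert]

lemma mgf_block {p : ℝ} (hp0 : 0 < p) (hp1 : p ≤ 1) (B : Finset (Sym2 V))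
    (Y : Finset (Sym2 V) → ℝ) (a l K : ℝ) (hl : |l| ≤ 1)
    (h : ∀ F ⊆ B, a ≤ Y F ∧ Y F ≤ a + 1)
    (hK : (expVal p B Y - a) * (1 - (expVal p B Y - a)) ≤ K) :
    expVal p B (fun F => Real.exp (l * Y F)) ≤ Real.exp (l * expVal p B Y + l ^ 2 * K) := by
  set μ := expVal p B Y with hμ
  have h1 : a ≤ μ := by
    rw [← expVal_const p a B]; exact expVal_mono hp0 hp1 B fun F hF => (h F hF).1
  have h2 : μ ≤ a + 1 := by
    rw [← expVal_const p (a + 1) B]; exact expVal_mono hp0 hp1 B fun F hF => (h F hF).2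
  set m := μ - a with hm
  have key : ∀ F ⊆ B, Real.exp (l * Y F) ≤
      Real.exp (l * μ) * ((1 - l * μ - l ^ 2 * (1 - 2 * m) * a + l ^ 2 * m ^ 2)
        + (l + l ^ 2 * (1 - 2 * m)) * Y F) := by
    intro F hF
    obtain ⟨h3, h4⟩ := h F hF
    have h5 : |l * (Y F - μ)| ≤ 1 := by
      rw [abs_mul]
      have : |Y F - μ| ≤ 1 := abs_le.2 ⟨by linarith, by linarith⟩
      nlinarith [abs_nonneg l, abs_nonneg (Y F - μ)]
    have h6 := (abs_le.1 (Real.abs_exp_sub_one_sub_id_le h5)).2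
    have h7 : (Y F - μ) ^ 2 ≤ (1 - 2 * m) * (Y F - a) + m ^ 2 := by
      have : μ = m + a := by rw [hm]; ring
      rw [this]
      nlinarith [mul_nonneg (sub_nonneg.2 h3) (sub_nonneg.2 h4)]
    have h8 := mul_le_mul_of_nonneg_left h7 (sq_nonneg l)
    have h9 : Real.exp (l * Y F) = Real.exp (l * μ) * Real.exp (l * (Y F - μ)) := by
      rw [← Real.exp_add]; ring_nf
    rw [h9]
    refine mul_le_mul_of_nonneg_left ?_ (Real.exp_nonneg _)
    nlinarith
  refine (expVal_mono hp0 hp1 B key).trans ?_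
  rw [expVal_smul, expVal_add, expVal_const, expVal_smul, ← hμ, Real.exp_add]
  refine mul_le_mul_of_nonneg_left ?_ (Real.exp_nonneg _)
  have h10 := Real.add_one_le_exp (l ^ 2 * K)
  have h11 := mul_le_mul_of_nonneg_left hK (sq_nonneg l)
  have : a = μ - m := by rw [hm]; ring
  rw [this]
  nlinarith

/-- Monotone, and changing the edges at one vertex changes the value by at most one. -/
def GoodFn (X : Finset (Sym2 V) → ℝ) : Prop :=
  (∀ F F' : Finset (Sym2 V), F ⊆ F' → X F ≤ X F') ∧
  ∀ (v : V) (F F' : Finset (Sym2 V)), (∀ e, v ∉ e → (e ∈ F ↔ e ∈ F')) → X F ≤ X F' + 1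

lemma GoodFn.avg {p : ℝ} (hp0 : 0 < p) (hp1 : p ≤ 1) {X : Finset (Sym2 V) → ℝ} (hX : GoodFn X)
    (B : Finset (Sym2 V)) : GoodFn (fun F => expVal p B (fun F' => X (F ∪ F'))) := by
  refine ⟨fun F F' h => ?_, fun v F F' h => ?_⟩
  · exact expVal_mono hp0 hp1 B fun D _ => hX.1 _ _ (Finset.union_subset_union_left h)
  · have : expVal p B (fun D => X (F' ∪ D)) + 1 = expVal p B (fun D => X (F' ∪ D) + 1) := by
      rw [expVal_add, expVal_const]
    show expVal p B (fun D => X (F ∪ D)) ≤ expVal p B (fun D => X (F' ∪ D)) + 1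
    rw [this]
    refine expVal_mono hp0 hp1 B fun D _ => hX.2 v _ _ fun e he => ?_
    simp [h e he]

lemma mgf_step {p : ℝ} (hp0 : 0 < p) (hp1 : p ≤ 1) {X : Finset (Sym2 V) → ℝ} (hX : GoodFn X)
    (A B : Finset (Sym2 V)) (hAB : Disjoint A B) (l K L : ℝ) (hl : |l| ≤ 1)
    (v : V) (hv : ∀ e ∈ B, v ∈ e)
    (hK : ∀ F, (expVal p B (fun F' => X (F ∪ F')) - X F) *
      (1 - (expVal p B (fun F' => X (F ∪ F')) - X F)) ≤ K)
    (ih : ∀ Y : Finset (Sym2 V) → ℝ, GoodFn Y →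
      expVal p A (fun F => Real.exp (l * Y F)) ≤ Real.exp (l * expVal p A Y + l ^ 2 * L)) :
    expVal p (A ∪ B) (fun F => Real.exp (l * X F)) ≤
      Real.exp (l * expVal p (A ∪ B) X + l ^ 2 * (L + K)) := by
  rw [expVal_union p A B hAB, expVal_union p A B hAB]
  have h1 := ih _ (hX.avg hp0 hp1 B)
  have h2 : expVal p A (fun F => expVal p B (fun F' => Real.exp (l * X (F ∪ F')))) ≤
      expVal p A (fun F => Real.exp (l ^ 2 * K) *
        Real.exp (l * expVal p B (fun F' => X (F ∪ F')))) := by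
    refine expVal_mono hp0 hp1 A fun F _ => ?_
    rw [← Real.exp_add, add_comm]
    refine mgf_block hp0 hp1 B (fun F' => X (F ∪ F')) (X F) l K hl (fun F' hF' => ⟨?_, ?_⟩) (hK F)
    · exact hX.1 _ _ Finset.subset_union_left
    · refine hX.2 v _ _ fun e he => ?_
      have : e ∉ F' := fun h => he (hv e (hF' h))
      simp [this]
  refine h2.trans ?_
  rw [expVal_smul]
  refine (mul_le_mul_of_nonneg_left h1 (Real.exp_nonneg _)).trans (le_of_eq ?_)
  rw [← Real.exp_add]; ring_nf

lemma mgf_edges {p : ℝ} (hp0 : 0 < p) (hp1 : p ≤ 1) (l : ℝ) (hl : |l| ≤ 1)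
    (E : Finset (Sym2 V)) : ∀ X : Finset (Sym2 V) → ℝ, GoodFn X →
      expVal p E (fun F => Real.exp (l * X F)) ≤
        Real.exp (l * expVal p E X + l ^ 2 * (p * E.card)) := by
  induction E using Finset.induction_on with
  | empty => intro X _; simp [expVal_empty]
  | insert e E he ih =>
    intro X hX
    obtain ⟨v, hv⟩ : ∃ v, v ∈ e := by
      induction e using Sym2.ind with
      | _ a b => exact ⟨a, by simp⟩
    have h := mgf_step hp0 hp1 hX E {e} (by simpa using he) l p (p * E.card) hl v
      (by intro e' h'; rw [Finset.mem_singleton.1 h']; exact hv) ?_ ih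
    · rw [Finset.card_insert_of_notMem he]
      have h3 : E ∪ {e} = insert e E := by ext x; simp [or_comm]
      rw [h3] at h
      refine h.trans (le_of_eq ?_)
      push_cast; ring_nf
    · intro F
      have h4 : expVal p {e} (fun F' => X (F ∪ F')) = (1 - p) * X F + p * X (insert e F) := by
        have : ({e} : Finset (Sym2 V)) = insert e ∅ := rfl
        rw [this, expVal_insert p ∅ e (by simp), expVal_empty, expVal_empty]
        simp [Finset.union_insert]
      rw [h4]
      have h5 : X F ≤ X (insert e F) := hX.1 _ _ (Finset.subset_insert _ _)
      have h6 : X (insert e F) ≤ X F + 1 := hX.2 v _ _ fun e' he' => by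
        have : e' ≠ e := fun h => he' (h ▸ hv)
        simp [this]
      have h7 : (1 - p) * X F + p * X (insert e F) - X F = p * (X (insert e F) - X F) := by ring
      rw [h7]
      set δ := X (insert e F) - X F
      have : 0 ≤ δ := by simp only [δ]; linarith
      have : δ ≤ 1 := by simp only [δ]; linarith
      nlinarith [mul_nonneg hp0.le (sub_nonneg.2 this), sq_nonneg (p * δ)]

lemma mgf_main {p : ℝ} (hp0 : 0 < p) (hp1 : p ≤ 1) (l : ℝ) (hl : |l| ≤ 1) (S : Finset V) :
    ∀ (E : Finset (Sym2 V)) (X : Finset (Sym2 V) → ℝ), GoodFn X →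
      expVal p E (fun F => Real.exp (l * X F)) ≤
        Real.exp (l * expVal p E X +
          l ^ 2 * (p * (E.filter fun e => ∀ v ∈ e, v ∉ S).card + S.card / 4)) := by
  induction S using Finset.induction_on with
  | empty =>
    intro E X hX
    simpa using mgf_edges hp0 hp1 l hl E X hX
  | insert v S hv ih =>
    intro E X hX
    have hd : Disjoint (E.filter fun e => ¬ v ∈ e) (E.filter fun e => v ∈ e) :=
      (Finset.disjoint_filter_filter_not E E (fun e => v ∈ e)).symm
    have hu : (E.filter fun e => ¬ v ∈ e) ∪ (E.filter fun e => v ∈ e) = E := by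
      rw [Finset.union_comm]; exact Finset.filter_union_filter_not_eq _ _
    have h := mgf_step hp0 hp1 hX _ _ hd l (1 / 4) _ hl v (by simp)
      (fun F => by nlinarith [sq_nonneg (expVal p (E.filter fun e => v ∈ e)
        (fun F' => X (F ∪ F')) - X F - 1 / 2)]) (ih _)
    rw [hu] at h
    refine h.trans (le_of_eq ?_)
    have h2 : ((E.filter fun e => ¬ v ∈ e).filter fun e => ∀ u ∈ e, u ∉ S) =
        E.filter fun e => ∀ u ∈ e, u ∉ insert v S := by
      ext e
      simp only [Finset.mem_filter, Finset.mem_insert, not_or]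
      constructor
      · rintro ⟨⟨h1, h2⟩, h3⟩
        exact ⟨h1, fun u hu => ⟨fun h => h2 (h ▸ hu), h3 u hu⟩⟩
      · rintro ⟨h1, h2⟩
        exact ⟨⟨h1, fun h => (h2 v h).1 rfl⟩, fun u hu => (h2 u hu).2⟩
    rw [h2, Finset.card_insert_of_notMem hv]
    push_cast; ring_nf

lemma exp_lin (p : ℝ) (E : Finset (Sym2 V)) (a : Sym2 V → ℝ) :
    expVal p E (fun F => ∑ e ∈ F, a e) = p * ∑ e ∈ E, a e := by
  induction E using Finset.induction_on with
  | empty => simp [expVal_empty]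
  | insert e E he ih =>
    have : expVal p E (fun F => ∑ x ∈ insert e F, a x) =
        expVal p E (fun F => a e + ∑ x ∈ F, a x) := by
      refine Finset.sum_congr rfl fun F hF => ?_
      show _ * (∑ x ∈ insert e F, a x) = _
      rw [Finset.sum_insert fun h => he (Finset.mem_powerset.1 hF h)]
    rw [expVal_insert p E e he, this, expVal_add, expVal_const, ih, Finset.sum_insert he]
    ring

lemma exp_sq (p : ℝ) (E : Finset (Sym2 V)) (a : Sym2 V → ℝ) :
    expVal p E (fun F => (∑ e ∈ F, a e) ^ 2) =
      (p * ∑ e ∈ E, a e) ^ 2 + p * (1 - p) * ∑ e ∈ E, a e ^ 2 := by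
  induction E using Finset.induction_on with
  | empty => simp [expVal_empty]
  | insert e E he ih =>
    have : expVal p E (fun F => (∑ x ∈ insert e F, a x) ^ 2) =
        expVal p E (fun F => (a e ^ 2 + 2 * a e * ∑ x ∈ F, a x) + (∑ x ∈ F, a x) ^ 2) := by
      refine Finset.sum_congr rfl fun F hF => ?_
      show _ * (∑ x ∈ insert e F, a x) ^ 2 = _
      rw [Finset.sum_insert fun h => he (Finset.mem_powerset.1 hF h)]
      ring
    rw [expVal_insert p E e he, this, expVal_add, expVal_add, expVal_const, expVal_smul, exp_lin,
      ih, Finset.sum_insert he, Finset.sum_insert he]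
    ring

/-- Greedy maximal fractional matching with edge capacity `p` and vertex capacity `1/2`. -/
lemma exists_frac {p : ℝ} (hp0 : 0 < p) (E : Finset (Sym2 V)) :
    ∃ z : Sym2 V → ℝ, (∀ e, 0 ≤ z e ∧ z e ≤ p) ∧
      (∀ v, ∑ e ∈ E, (if v ∈ e then z e else 0) ≤ 1 / 2) ∧
      ∀ e ∈ E, z e = p ∨ ∃ v ∈ e, ∑ e ∈ E, (if v ∈ e then z e else 0) = 1 / 2 := by
  induction E using Finset.induction_on with
  | empty => exact ⟨fun _ => 0, fun _ => ⟨le_rfl, hp0.le⟩, by simp, by simp⟩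
  | insert e E he ih =>
    obtain ⟨z, hz, hm, hs⟩ := ih
    set m : V → ℝ := fun v => ∑ e ∈ E, (if v ∈ e then z e else 0) with hmdef
    obtain ⟨t, ht0, htp, hte, htx⟩ : ∃ t : ℝ, 0 ≤ t ∧ t ≤ p ∧ (∀ v ∈ e, t + m v ≤ 1 / 2) ∧
        (t = p ∨ ∃ v ∈ e, t + m v = 1 / 2) := by
      induction e using Sym2.ind with
      | _ a b =>
        have ha : m a ≤ 1 / 2 := hm a
        have hb : m b ≤ 1 / 2 := hm b
        refine ⟨min p (min (1 / 2 - m a) (1 / 2 - m b)), ?_, min_le_left _ _, ?_, ?_⟩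
        · exact le_min hp0.le (le_min (by linarith) (by linarith))
        · intro v hv
          have h1 := min_le_right p (min (1 / 2 - m a) (1 / 2 - m b))
          have h2 := min_le_left (1 / 2 - m a) (1 / 2 - m b)
          have h3 := min_le_right (1 / 2 - m a) (1 / 2 - m b)
          rcases Sym2.mem_iff.1 hv with rfl | rfl <;> linarith
        · rcases min_choice p (min (1 / 2 - m a) (1 / 2 - m b)) with h | h
          · exact Or.inl h
          · right
            rcases min_choice (1 / 2 - m a) (1 / 2 - m b) with h' | h'
            · exact ⟨a, by simp, by rw [h, h']; ring⟩
            · exact ⟨b, by simp, by rw [h, h']; ring⟩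
    have hsum : ∀ v, ∑ x ∈ insert e E, (if v ∈ x then Function.update z e t x else 0) =
        (if v ∈ e then t else 0) + m v := by
      intro v
      rw [Finset.sum_insert he, Function.update_self]
      congr 1
      refine Finset.sum_congr rfl fun x hx => ?_
      rw [Function.update_of_ne (show x ≠ e from fun h => he (h ▸ hx))]
    have hle : ∀ v, (if v ∈ e then t else 0) + m v ≤ 1 / 2 := by
      intro v
      split_ifs with h
      · exact hte v h
      · rw [zero_add]; exact hm v
    refine ⟨Function.update z e t, fun x => ?_, fun v => ?_, fun x hx => ?_⟩
    · by_cases hxe : x = e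
      · subst hxe; rw [Function.update_self]; exact ⟨ht0, htp⟩
      · rw [Function.update_of_ne hxe]; exact hz x
    · rw [hsum]; exact hle v
    · rcases Finset.mem_insert.1 hx with rfl | hx
      · rw [Function.update_self]
        rcases htx with h | ⟨v, hv, h⟩
        · exact Or.inl h
        · refine Or.inr ⟨v, hv, ?_⟩
          rw [hsum, if_pos hv]; exact h
      · rw [Function.update_of_ne (show x ≠ e from fun h => he (h ▸ hx))]
        rcases hs x hx with h | ⟨v, hv, h⟩
        · exact Or.inl h
        · refine Or.inr ⟨v, hv, ?_⟩
          rw [hsum]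
          refine le_antisymm (hle v) ?_
          have h' : m v = 1 / 2 := h
          rw [h']
          split_ifs <;> linarith

lemma sum_mem_le (S : Finset V) (e : Sym2 V) (c : ℝ) (hc : 0 ≤ c) :
    ∑ v ∈ S, (if v ∈ e then c else 0) ≤ 2 * c := by
  rw [← Finset.sum_filter, Finset.sum_const, nsmul_eq_mul]
  refine mul_le_mul_of_nonneg_right ?_ hc
  have : (S.filter fun v => v ∈ e).card ≤ 2 := by
    induction e using Sym2.ind with
    | _ a b =>
      refine (Finset.card_le_card (t := {a, b}) ?_).trans Finset.card_le_two
      intro x hx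
      simpa using (Finset.mem_filter.1 hx).2
  exact_mod_cast this

lemma exists_set {p : ℝ} (hp0 : 0 < p) (hp1 : p ≤ 1) (E : Finset (Sym2 V))
    (C : Finset (Sym2 V) → Finset V) (hC : ∀ F ⊆ E, IsCoverOf (C F) F) :
    ∃ S : Finset V, p * (E.filter fun e => ∀ v ∈ e, v ∉ S).card + (S.card : ℝ) / 4 ≤
      4 * expVal p E (fun F => ((C F).card : ℝ)) := by
  obtain ⟨z, hz, hm, hs⟩ := exists_frac hp0 E
  set m : V → ℝ := fun v => ∑ e ∈ E, (if v ∈ e then z e else 0) with hmdef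
  have hm0 : ∀ v, 0 ≤ m v := fun v => Finset.sum_nonneg fun e _ => by
    split_ifs
    · exact (hz e).1
    · exact le_rfl
  have hm2 : ∑ v, m v ≤ 2 * ∑ e ∈ E, z e := by
    simp only [hmdef]
    rw [Finset.sum_comm, Finset.mul_sum]
    exact Finset.sum_le_sum fun e _ => sum_mem_le _ e _ (hz e).1
  -- lower bound on the expectation
  have hlow : ∑ e ∈ E, z e ≤ 4 * expVal p E (fun F => ((C F).card : ℝ)) := by
    set w : V → Sym2 V → ℝ := fun v e => if v ∈ e then z e / p else 0 with hw
    have hw0 : ∀ v e, 0 ≤ w v e := fun v e => by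
      simp only [hw]; split_ifs
      · exact div_nonneg (hz e).1 hp0.le
      · exact le_rfl
    have hw1 : ∀ v e, w v e ≤ 1 := fun v e => by
      simp only [hw]; split_ifs
      · exact (div_le_one hp0).2 (hz e).2
      · exact zero_le_one
    have hwm : ∀ v, p * ∑ e ∈ E, w v e = m v := fun v => by
      rw [Finset.mul_sum]
      refine Finset.sum_congr rfl fun e _ => ?_
      simp only [hw]; split_ifs
      · field_simp
      · simp
    have h1 : ∀ F ⊆ E, ∑ e ∈ F, z e / p ≤
        ((C F).card : ℝ) + ∑ v, (1 / 4) * (∑ e ∈ F, w v e) ^ 2 := by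
      intro F hF
      calc ∑ e ∈ F, z e / p ≤ ∑ e ∈ F, ∑ v ∈ C F, w v e := by
            refine Finset.sum_le_sum fun e he => ?_
            obtain ⟨v, hv, hve⟩ := hC F hF e he
            have := Finset.single_le_sum (f := fun v => w v e) (fun v _ => hw0 v e) hv
            simpa [hw, hve] using this
        _ = ∑ v ∈ C F, ∑ e ∈ F, w v e := Finset.sum_comm
        _ ≤ ∑ v ∈ C F, (1 + (1 / 4) * (∑ e ∈ F, w v e) ^ 2) := by
            refine Finset.sum_le_sum fun v _ => ?_
            nlinarith [sq_nonneg (∑ e ∈ F, w v e - 2)]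
        _ = ((C F).card : ℝ) + ∑ v ∈ C F, (1 / 4) * (∑ e ∈ F, w v e) ^ 2 := by
            rw [Finset.sum_add_distrib]; simp
        _ ≤ _ := by
            gcongr
            exact Finset.subset_univ _
    have h2 := expVal_mono hp0 hp1 E h1
    rw [exp_lin, expVal_add, expVal_sum] at h2
    have h3 : p * ∑ e ∈ E, z e / p = ∑ e ∈ E, z e := by
      rw [← Finset.sum_div]; field_simp
    have h4 : ∑ v, expVal p E (fun F => (1 / 4) * (∑ e ∈ F, w v e) ^ 2) ≤
        ∑ v, (3 / 8) * m v := by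
      refine Finset.sum_le_sum fun v _ => ?_
      rw [expVal_smul, exp_sq, hwm]
      have h5 : ∑ e ∈ E, w v e ^ 2 ≤ ∑ e ∈ E, w v e :=
        Finset.sum_le_sum fun e _ => by nlinarith [hw0 v e, hw1 v e]
      have h6 : p * (1 - p) * ∑ e ∈ E, w v e ^ 2 ≤ m v := by
        rw [← hwm]
        have h7 : 0 ≤ ∑ e ∈ E, w v e ^ 2 := Finset.sum_nonneg fun e _ => sq_nonneg _
        nlinarith [mul_nonneg (mul_nonneg hp0.le hp0.le) h7, mul_le_mul_of_nonneg_left h5 hp0.le]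
      have h8 : m v ≤ 1 / 2 := hm v
      nlinarith [hm0 v]
    rw [← Finset.mul_sum] at h4
    linarith
  refine ⟨Finset.univ.filter fun v => m v = 1 / 2, le_trans ?_ hlow⟩
  set S : Finset V := Finset.univ.filter fun v => m v = 1 / 2 with hS
  have h1 : (S.card : ℝ) / 2 = ∑ v ∈ S, m v := by
    rw [Finset.sum_congr rfl (g := fun _ => (1 / 2 : ℝ)) fun v hv => (Finset.mem_filter.1 hv).2]
    rw [Finset.sum_const, nsmul_eq_mul]; ring
  have h2 : ∑ v ∈ S, m v ≤ ∑ e ∈ E, (if ∀ v ∈ e, v ∉ S then 0 else 2 * z e) := by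
    simp only [hmdef]
    rw [Finset.sum_comm]
    refine Finset.sum_le_sum fun e _ => ?_
    split_ifs with h
    · refine le_of_eq (Finset.sum_eq_zero fun v hv => ?_)
      rw [if_neg fun hve => h v hve hv]
    · exact sum_mem_le _ e _ (hz e).1
  have h3 : p * ((E.filter fun e => ∀ v ∈ e, v ∉ S).card : ℝ) =
      ∑ e ∈ E, (if ∀ v ∈ e, v ∉ S then z e else 0) := by
    rw [← Finset.sum_filter, Finset.sum_congr rfl (g := fun _ => p)]
    · simp; ring
    · intro e he
      obtain ⟨he, h⟩ := Finset.mem_filter.1 he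
      rcases hs e he with h' | ⟨v, hv, h'⟩
      · exact h'
      · exact absurd (Finset.mem_filter.2 ⟨Finset.mem_univ v, h'⟩) (h v hv)
  have h4 : ∑ e ∈ E, (if ∀ v ∈ e, v ∉ S then z e else 0) +
      (∑ e ∈ E, (if ∀ v ∈ e, v ∉ S then 0 else 2 * z e)) / 2 = ∑ e ∈ E, z e := by
    rw [Finset.sum_div, ← Finset.sum_add_distrib]
    refine Finset.sum_congr rfl fun e _ => ?_
    split_ifs <;> ring
  linarith

lemma good_mvc (E : Finset (Sym2 V)) (MVC : Finset (Sym2 V) → Finset V)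
    (h : IsMinCoverFn E MVC) : GoodFn (fun F => ((MVC (F ∩ E)).card : ℝ)) := by
  refine ⟨fun F F' hF => ?_, fun v F F' hF => ?_⟩
  · have := (h (F ∩ E) Finset.inter_subset_right).2 (MVC (F' ∩ E)) fun e he =>
      (h (F' ∩ E) Finset.inter_subset_right).1 e (Finset.inter_subset_inter_right hF he)
    exact Nat.cast_le.2 this
  · have h1 := (h (F ∩ E) Finset.inter_subset_right).2 (insert v (MVC (F' ∩ E))) fun e he => by
      by_cases hv : v ∈ e
      · exact ⟨v, Finset.mem_insert_self _ _, hv⟩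
      · obtain ⟨he1, he2⟩ := Finset.mem_inter.1 he
        obtain ⟨u, hu, hue⟩ := (h (F' ∩ E) Finset.inter_subset_right).1 e
          (Finset.mem_inter.2 ⟨(hF e hv).1 he1, he2⟩)
        exact ⟨u, Finset.mem_insert_of_mem hu, hue⟩
    have h2 := h1.trans (Finset.card_insert_le _ _)
    show ((MVC (F ∩ E)).card : ℝ) ≤ ((MVC (F' ∩ E)).card : ℝ) + 1
    exact_mod_cast h2


/-- Corollary 5.4. Let `Z = |MVC(G*)|` and `opt = E[Z]`.
Then for every `t` with `0 ≤ t ≤ opt`, `Pr[|Z - opt| > t] ≤ 2·exp(−(t²/33)/opt)`. -/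
theorem mvc_concentration_corollary
    (G : SimpleGraph V) [DecidableRel G.Adj]
    (p : ℝ) (hp0 : 0 < p) (hp1 : p ≤ 1)
    (MVC : Finset (Sym2 V) → Finset V)
    (hMVC : IsMinCoverFn G.edgeFinset MVC)
    (opt : ℝ) (hopt : opt = optVal p G.edgeFinset MVC)
    (t : ℝ) (ht0 : 0 ≤ t) (ht1 : t ≤ opt) :
    probEvent p G.edgeFinset (fun F => t < |((MVC F).card : ℝ) - opt|) ≤
      2 * Real.exp (-(t ^ 2 / 33) / opt) := by
  set E := G.edgeFinset with hE
  obtain ⟨S, hS⟩ := exists_set hp0 hp1 E MVC fun F hF => (hMVC F hF).1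
  have hopt' : expVal p E (fun F => ((MVC F).card : ℝ)) = opt := hopt.symm
  rw [hopt'] at hS
  have hmgf : ∀ l : ℝ, |l| ≤ 1 → expVal p E (fun F => Real.exp (l * ((MVC F).card : ℝ))) ≤
      Real.exp (l * opt + l ^ 2 * (4 * opt)) := by
    intro l hl
    have h1 := mgf_main hp0 hp1 l hl S E _ (good_mvc E MVC hMVC)
    have h2 : ∀ f : ℝ → ℝ, expVal p E (fun F => f ((MVC (F ∩ E)).card : ℝ)) =
        expVal p E (fun F => f ((MVC F).card : ℝ)) := fun f =>
      Finset.sum_congr rfl fun F hF => by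
        beta_reduce
        rw [Finset.inter_eq_left.2 (Finset.mem_powerset.1 hF)]
    have h3 := h2 (fun x => Real.exp (l * x))
    have h4 := h2 (fun x => x)
    rw [h3, h4, hopt'] at h1
    refine h1.trans (Real.exp_le_exp.2 ?_)
    have := mul_le_mul_of_nonneg_left hS (sq_nonneg l)
    linarith
  have hopt0 : 0 ≤ opt := ht0.trans ht1
  obtain ⟨s, hs0, hs1, hts⟩ : ∃ s : ℝ, 0 ≤ s ∧ s ≤ 1 ∧ t = s * opt := by
    rcases hopt0.eq_or_lt with h | h
    · exact ⟨0, le_rfl, zero_le_one, by rw [zero_mul]; linarith⟩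
    · exact ⟨t / opt, div_nonneg ht0 hopt0, (div_le_one h).2 ht1, by field_simp⟩
  have htail : ∀ l : ℝ, |l| ≤ 1 → l ^ 2 = s ^ 2 / 64 →
      expVal p E (fun F => Real.exp (-(l * opt) - s / 8 * t) *
        Real.exp (l * ((MVC F).card : ℝ))) ≤ Real.exp (-(t ^ 2 / 33) / opt) := by
    intro l hl hl2
    rw [expVal_smul]
    refine (mul_le_mul_of_nonneg_left (hmgf l hl) (Real.exp_nonneg _)).trans ?_
    rw [← Real.exp_add, Real.exp_le_exp, hl2, hts]
    have h5 : -((s * opt) ^ 2 / 33) / opt = -(s ^ 2 * opt / 33) := by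
      rcases hopt0.eq_or_lt with h | h
      · rw [← h]; simp
      · field_simp
    rw [h5]
    nlinarith [mul_nonneg (sq_nonneg s) hopt0]
  have hb1 := htail (s / 8) (by rw [abs_of_nonneg (by linarith)]; linarith) (by ring)
  have hb2 := htail (-(s / 8)) (by rw [abs_neg, abs_of_nonneg (by linarith)]; linarith) (by ring)
  have hle : probEvent p E (fun F => t < |((MVC F).card : ℝ) - opt|) ≤
      expVal p E (fun F => Real.exp (-(s / 8 * opt) - s / 8 * t) *
        Real.exp (s / 8 * ((MVC F).card : ℝ)) + Real.exp (-(-(s / 8) * opt) - s / 8 * t) *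
        Real.exp (-(s / 8) * ((MVC F).card : ℝ))) := by
    unfold probEvent expVal
    refine Finset.sum_le_sum fun F _ => ?_
    have hw := edgeWeight_nonneg hp0 hp1 E F
    beta_reduce
    rw [← Real.exp_add, ← Real.exp_add]
    split_ifs with h
    · refine le_mul_of_one_le_right hw ?_
      rcases lt_abs.1 h with h | h
      · have h6 : (1 : ℝ) ≤ Real.exp (-(s / 8 * opt) - s / 8 * t + s / 8 * ((MVC F).card : ℝ)) :=
          Real.one_le_exp (by nlinarith)
        have := Real.exp_nonneg (-(-(s / 8) * opt) - s / 8 * t + -(s / 8) * ((MVC F).card : ℝ))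
        linarith
      · have h6 : (1 : ℝ) ≤
            Real.exp (-(-(s / 8) * opt) - s / 8 * t + -(s / 8) * ((MVC F).card : ℝ)) :=
          Real.one_le_exp (by nlinarith)
        have := Real.exp_nonneg (-(s / 8 * opt) - s / 8 * t + s / 8 * ((MVC F).card : ℝ))
        linarith
    · exact mul_nonneg hw (add_nonneg (Real.exp_nonneg _) (Real.exp_nonneg _))
  rw [expVal_add] at hle
  linarith
end
end

section
/- For any ε ∈ (0,1] and n ≥ 6, the set W = {e = (u,v) ∈ E : Pr[u ∈ MVC(G*) or v ∈ MVC(G*)] ≤ 1 − ε} of edges whose probability of being covered by MVC(G*) is at most 1 − ε satisfies |W| ≤ 2n/(p·ε). -/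
open Finset

noncomputable section
open scoped Classical

variable {V : Type*} [Fintype V] [DecidableEq V]

lemma aux_w_nonneg {V : Type*} [DecidableEq V] {p : ℝ} (hp0 : 0 < p) (hp1 : p ≤ 1)
    (E F : Finset (Sym2 V)) : 0 ≤ edgeWeight p E F := by
  unfold edgeWeight
  have : 0 ≤ 1 - p := by linarith
  positivity

lemma aux_avoid {V : Type*} [DecidableEq V] (p : ℝ) (E D : Finset (Sym2 V)) (hD : D ⊆ E) :
    ∑ F ∈ (E \ D).powerset, edgeWeight p E F = (1 - p) ^ D.card := by
  have h := Finset.sum_pow_mul_eq_add_pow p (1 - p) (E \ D)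
  have h2 : ∑ F ∈ (E \ D).powerset, edgeWeight p E F
      = ∑ F ∈ (E \ D).powerset,
        (1 - p) ^ D.card * (p ^ F.card * (1 - p) ^ ((E \ D).card - F.card)) := by
    refine Finset.sum_congr rfl fun F hF => ?_
    have hF' := Finset.mem_powerset.1 hF
    have hFE : F ⊆ E := hF'.trans Finset.sdiff_subset
    unfold edgeWeight
    have c1 := Finset.card_sdiff_of_subset hFE
    have c2 := Finset.card_sdiff_of_subset hD
    have c3 := Finset.card_le_card hF'
    have c4 := Finset.card_le_card hD
    have : (E \ F).card = D.card + ((E \ D).card - F.card) := by omega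
    rw [this, pow_add]; ring
  rw [h2, ← Finset.mul_sum, h]
  simp

lemma aux_total {V : Type*} [DecidableEq V] (p : ℝ) (E : Finset (Sym2 V)) :
    ∑ F ∈ E.powerset, edgeWeight p E F = 1 := by
  have := aux_avoid p E ∅ (by simp)
  simpa using this

lemma aux_exp {V : Type*} [Fintype V] [DecidableEq V] {p : ℝ} (hp0 : 0 < p) (hp1 : p ≤ 1)
    (E : Finset (Sym2 V)) (MVC : Finset (Sym2 V) → Finset V)
    (hM : ∀ F ⊆ E, IsCoverOf (MVC F) F)
    (D : Finset V → Finset (Sym2 V)) (hDE : ∀ C, D C ⊆ E)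
    (hD : ∀ C, ∀ e ∈ D C, ∀ v ∈ e, v ∉ C) :
    ∑ F ∈ E.powerset, edgeWeight p E F * Real.exp (p * (D (MVC F)).card)
      ≤ 2 ^ Fintype.card V := by
  calc ∑ F ∈ E.powerset, edgeWeight p E F * Real.exp (p * (D (MVC F)).card)
      ≤ ∑ F ∈ E.powerset, ∑ C : Finset V,
          if F ⊆ E \ D C then edgeWeight p E F * Real.exp (p * (D C).card) else 0 := by
        refine Finset.sum_le_sum fun F hF => ?_
        have hFE := Finset.mem_powerset.1 hF
        have hs : F ⊆ E \ D (MVC F) := by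
          intro e he
          refine Finset.mem_sdiff.2 ⟨hFE he, fun h => ?_⟩
          obtain ⟨v, hv, hve⟩ := hM F hFE e he
          exact hD _ e h v hve hv
        have := Finset.single_le_sum (s := (Finset.univ : Finset (Finset V)))
          (f := fun C => if F ⊆ E \ D C then
            edgeWeight p E F * Real.exp (p * (D C).card) else 0)
          (fun C _ => by
            split_ifs
            · exact mul_nonneg (aux_w_nonneg hp0 hp1 E F) (Real.exp_pos _).le
            · exact le_rfl) (Finset.mem_univ (MVC F))
        simpa only [if_pos hs] using this
    _ = ∑ C : Finset V, (1 - p) ^ (D C).card * Real.exp (p * (D C).card) := by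
        rw [Finset.sum_comm]
        refine Finset.sum_congr rfl fun C _ => ?_
        rw [← aux_avoid p E (D C) (hDE C), Finset.sum_mul, ← Finset.sum_filter]
        refine Finset.sum_congr ?_ fun _ _ => rfl
        ext F
        simp only [Finset.mem_filter, Finset.mem_powerset]
        exact ⟨fun h => h.2, fun h => ⟨h.trans Finset.sdiff_subset, h⟩⟩
    _ ≤ ∑ C : Finset V, (1 : ℝ) := by
        refine Finset.sum_le_sum fun C _ => ?_
        rw [mul_comm p, Real.exp_nat_mul, ← mul_pow]
        have h1 : 1 - p ≤ Real.exp (-p) := by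
          have := Real.add_one_le_exp (-p); linarith
        refine pow_le_one₀ (mul_nonneg (by linarith) (Real.exp_pos _).le) ?_
        calc (1 - p) * Real.exp p ≤ Real.exp (-p) * Real.exp p :=
              mul_le_mul_of_nonneg_right h1 (Real.exp_pos _).le
          _ = 1 := by rw [← Real.exp_add]; simp
    _ = 2 ^ Fintype.card V := by simp

/-- from Lemma 4.6, cf. [DDH23]. For any `ε ∈ (0,1]` and `n ≥ 6`, the
set `W = {e = (u,v) ∈ E : Pr[u ∈ MVC(G*) or v ∈ MVC(G*)] ≤ 1 − ε}` of edges whose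
probability of being covered by `MVC(G*)` is at most `1 − ε` satisfies
`|W| ≤ 2n/(p·ε)`. -/
theorem rarely_covered_edges_bound
    (G : SimpleGraph V) [DecidableRel G.Adj]
    (p : ℝ) (hp0 : 0 < p) (hp1 : p ≤ 1)
    (MVC : Finset (Sym2 V) → Finset V)
    (hMVC : IsMinCoverFn G.edgeFinset MVC)
    (ε : ℝ) (hε0 : 0 < ε) (hε1 : ε ≤ 1)
    (hn : 6 ≤ Fintype.card V)
    (W : Finset (Sym2 V))
    (hW : W = G.edgeFinset.filter fun e =>
      probEvent p G.edgeFinset (fun F => ∃ v ∈ e, v ∈ MVC F) ≤ 1 - ε) :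
    (W.card : ℝ) ≤ 2 * Fintype.card V / (p * ε) := by
  set E := G.edgeFinset with hE
  have hWE : W ⊆ E := by rw [hW]; exact Finset.filter_subset _ _
  have hWp : ∀ e ∈ W, probEvent p E (fun F => ∃ v ∈ e, v ∈ MVC F) ≤ 1 - ε := by
    intro e he
    rw [hW] at he
    exact (Finset.mem_filter.1 he).2
  let D : Finset V → Finset (Sym2 V) := fun C => W.filter fun e => ¬ ∃ v ∈ e, v ∈ C
  have hexp := aux_exp hp0 hp1 E MVC (fun F hF => (hMVC F hF).1) D
    (fun C => (Finset.filter_subset _ _).trans hWE)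
    (fun C e he v hv hvC => (Finset.mem_filter.1 he).2 ⟨v, hv, hvC⟩)
  have htot := aux_total p E
  have h1 : ε * W.card ≤ ∑ F ∈ E.powerset, edgeWeight p E F * ((D (MVC F)).card : ℝ) := by
    have h2 : ∑ F ∈ E.powerset, edgeWeight p E F * ((D (MVC F)).card : ℝ)
        = ∑ e ∈ W, (1 - probEvent p E (fun F => ∃ v ∈ e, v ∈ MVC F)) := by
      have h3 : ∀ e ∈ W, (1 - probEvent p E (fun F => ∃ v ∈ e, v ∈ MVC F))
          = ∑ F ∈ E.powerset, edgeWeight p E F * (if ¬ ∃ v ∈ e, v ∈ MVC F then (1:ℝ) else 0) := by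
        intro e _
        nth_rewrite 1 [← htot]
        unfold probEvent
        rw [← Finset.sum_sub_distrib]
        refine Finset.sum_congr rfl fun F _ => ?_
        by_cases h : ∃ v ∈ e, v ∈ MVC F
        · rw [if_pos h, if_neg (not_not.2 h)]; ring
        · rw [if_neg h, if_pos h]; ring
      rw [Finset.sum_congr rfl h3, Finset.sum_comm]
      refine Finset.sum_congr rfl fun F _ => ?_
      rw [← Finset.mul_sum, Finset.sum_boole]
    rw [h2]
    calc ε * W.card = ∑ e ∈ W, ε := by simp [mul_comm]
      _ ≤ _ := Finset.sum_le_sum fun e he => by linarith [hWp e he]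
  have hN : (0:ℝ) < 2 ^ Fintype.card V := by positivity
  set n : ℝ := (Fintype.card V : ℝ) with hnn
  have hlog : Real.exp (n * Real.log 2) = 2 ^ Fintype.card V := by
    rw [hnn, Real.exp_nat_mul, Real.exp_log (by norm_num)]
  have h4 : p * ∑ F ∈ E.powerset, edgeWeight p E F * ((D (MVC F)).card : ℝ)
      ≤ n * Real.log 2 := by
    calc p * ∑ F ∈ E.powerset, edgeWeight p E F * ((D (MVC F)).card : ℝ)
        ≤ ∑ F ∈ E.powerset, (edgeWeight p E F * (n * Real.log 2 - 1)
            + edgeWeight p E F * Real.exp (p * (D (MVC F)).card) / 2 ^ Fintype.card V) := by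
          rw [Finset.mul_sum]
          refine Finset.sum_le_sum fun F _ => ?_
          have h5 := Real.add_one_le_exp (p * ((D (MVC F)).card : ℝ) - n * Real.log 2)
          rw [Real.exp_sub, hlog] at h5
          have := mul_le_mul_of_nonneg_left h5 (aux_w_nonneg hp0 hp1 E F)
          rw [mul_div_assoc]
          linarith
      _ ≤ n * Real.log 2 := by
          rw [Finset.sum_add_distrib, ← Finset.sum_mul, htot, ← Finset.sum_div]
          have := (div_le_one hN).2 hexp
          linarith
  have hl2 : Real.log 2 ≤ 2 := by
    have := Real.log_le_sub_one_of_pos (show (0:ℝ) < 2 by norm_num)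
    linarith
  have hn0 : 0 ≤ n := by positivity
  rw [le_div_iff₀ (by positivity)]
  have h6 := mul_le_mul_of_nonneg_left h1 hp0.le
  have h7 := mul_le_mul_of_nonneg_left hl2 hn0
  linarith
end
end
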